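/- arXiv:1710.08694 — 7 statements merged into one kernel-verified Lean document; each statement's English description precedes it below -/
import Mathlib

section
/- For every dimension d ≥ 1 there is a bound D, depending only on d, on det(Λ) and on Nm(Λ), such that for every admissible lattice Λ ⊂ ℝ^d one has disp*(Λ) ≤ D < ∞; i.e., every axis-parallel box in ℝ^d that contains no point of Λ has volume at most D. -/
open MeasureTheory Set ENNReal

noncomputable section

/-- The lattice `T(ℤ^d)` generated by a matrix `T`. -/
def latticeOf {d : ℕ} (T : Matrix (Fin d) (Fin d) ℝ) : Set (Fin d → ℝ) :=
  Set.range fun z : Fin d → ℤ => T.mulVec fun i => (z i : ℝ)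

/-- `Λ` is a lattice in `ℝ^d`: the image of `ℤ^d` under an invertible matrix. -/
def IsLattice {d : ℕ} (Λ : Set (Fin d → ℝ)) : Prop :=
  ∃ T : Matrix (Fin d) (Fin d) ℝ, IsUnit T.det ∧ Λ = latticeOf T

/-- The norm minimum `Nm(Λ) = inf { ∏ |z_j| : z ∈ Λ \ {0} }`. -/
def Nm {d : ℕ} (Λ : Set (Fin d → ℝ)) : ℝ :=
  sInf {p : ℝ | ∃ z ∈ Λ, z ≠ 0 ∧ p = ∏ j, |z j|}

/-- An axis-parallel box: a product of bounded intervals of `ℝ`. -/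
def IsBox {d : ℕ} (B : Set (Fin d → ℝ)) : Prop :=
  ∃ I : Fin d → Set ℝ, (∀ i, Bornology.IsBounded (I i) ∧ (I i).OrdConnected) ∧
    B = Set.univ.pi I

/-- An axis-parallel box with all intervals contained in `[0,1]`. -/
def IsBoxIn01 {d : ℕ} (B : Set (Fin d → ℝ)) : Prop :=
  ∃ I : Fin d → Set ℝ, (∀ i, I i ⊆ Set.Icc (0 : ℝ) 1 ∧ (I i).OrdConnected) ∧
    B = Set.univ.pi I

/-- The lattice-dispersion: supremum of volumes of axis-parallel boxes avoiding `P`. -/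
def dispStar {d : ℕ} (P : Set (Fin d → ℝ)) : ℝ≥0∞ :=
  ⨆ B ∈ {B : Set (Fin d → ℝ) | IsBox B ∧ B ∩ P = ∅}, volume B

/-- The dispersion of a point set within the unit cube. -/
def disp {d : ℕ} (P : Set (Fin d → ℝ)) : ℝ≥0∞ :=
  ⨆ B ∈ {B : Set (Fin d → ℝ) | IsBoxIn01 B ∧ B ∩ P = ∅}, volume B

/-- Coordinatewise dilation `t⁻¹Λ = {(z_1/t_1, …, z_d/t_d) : z ∈ Λ}`. -/
def dilate {d : ℕ} (t : Fin d → ℝ) (Λ : Set (Fin d → ℝ)) : Set (Fin d → ℝ) :=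
  (fun z i => z i / t i) '' Λ

/-- The unit cube `[0,1]^d`. -/
def unitCube (d : ℕ) : Set (Fin d → ℝ) := Set.univ.pi fun _ => Set.Icc (0 : ℝ) 1

theorem covering_aux {d : ℕ} (b : Module.Basis (Fin d) ℝ (Fin d → ℝ)) (r ρ : ℝ) (hr : 0 < r) (hρ : 0 ≤ ρ)
    (hmin : ∀ z ∈ Submodule.span ℤ (Set.range b), z ≠ 0 → r ≤ ‖z‖) (c : Fin d → ℝ)
    (hc : ∀ z ∈ Submodule.span ℤ (Set.range b), ρ ≤ dist c z) :
    ENNReal.ofReal (ρ / r * r ^ d) ≤ volume (ZSpan.fundamentalDomain b) := by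
  set L := Submodule.span ℤ (Set.range b) with hL
  have hne : (L : Set (Fin d → ℝ)).Nonempty := ⟨0, L.zero_mem⟩
  set g : (Fin d → ℝ) → ℝ := fun x => Metric.infDist x (L : Set (Fin d → ℝ)) with hg
  have hgc : ρ ≤ g c := (Metric.le_infDist hne).2 (fun {z} hz => hc z hz)
  have hg0 : g 0 = 0 := Metric.infDist_zero_of_mem L.zero_mem
  have hcont : Continuous (fun t : ℝ => g (t • c)) :=
    (Metric.continuous_infDist_pt _).comp (continuous_id.smul continuous_const)
  have hinv : ∀ x, ∀ z ∈ L, g (z + x) = g x := by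
    have key : ∀ x, ∀ z ∈ L, g (z + x) ≤ g x := by
      intro x z hz
      refine (Metric.le_infDist hne).2 (fun {w} hw => ?_)
      have := Metric.infDist_le_dist_of_mem (x := z + x) (L.add_mem hz hw)
      simpa using this
    intro x z hz
    refine le_antisymm (key x z hz) ?_
    have := key (z + x) (-z) (L.neg_mem hz)
    simpa using this
  set K := ⌊ρ / r⌋₊ + 1 with hK
  have hp : ∀ k : ℕ, ∃ p : Fin d → ℝ, k < K → g p = k * r := by
    intro k
    by_cases hk : k < K
    · have h1 : (k : ℝ) * r ≤ ρ := by
        have : (k : ℝ) ≤ ρ / r := by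
          refine le_trans ?_ (Nat.floor_le (by positivity))
          exact_mod_cast Nat.lt_succ_iff.1 hk
        rwa [le_div_iff₀ hr] at this
      have := intermediate_value_Icc (zero_le_one (α := ℝ)) hcont.continuousOn
      obtain ⟨t, -, ht⟩ := this (show (k : ℝ) * r ∈ _ from ⟨by simp [hg0]; positivity, by simp; linarith⟩)
      exact ⟨t • c, fun _ => ht⟩
    · exact ⟨0, fun h => absurd h hk⟩
  choose p hp using hp
  set S : Set (Fin d → ℝ) := ⋃ k ∈ Finset.range K, Metric.ball (p k) (r / 2) with hS
  have hclose : ∀ x y, |g x - g y| ≤ dist x y := by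
    intro x y
    simpa [Real.dist_eq] using (Metric.lipschitz_infDist_pt (L : Set (Fin d → ℝ))).dist_le_mul x y
  have hsame : ∀ x y, ∀ j < K, ∀ k < K, x ∈ Metric.ball (p j) (r/2) → y ∈ Metric.ball (p k) (r/2) →
      g x = g y → j = k := by
    intro x y j hj k hk hx hy hxy
    have h1 := (hclose x (p j)).trans_lt hx
    have h2 := (hclose y (p k)).trans_lt hy
    rw [hp j hj] at h1
    rw [hp k hk] at h2
    rw [abs_lt] at h1 h2
    have h3 : ((j : ℝ) - k) < 1 := by
      by_contra h; push Not at h; nlinarith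
    have h4 : ((k : ℝ) - j) < 1 := by
      by_contra h; push Not at h; nlinarith
    have h5 : j < k + 1 := by exact_mod_cast (by linarith : (j : ℝ) < k + 1)
    have h6 : k < j + 1 := by exact_mod_cast (by linarith : (k : ℝ) < j + 1)
    omega
  have hvol : volume S = ENNReal.ofReal (K * r ^ d) := by
    rw [hS, measure_biUnion_finset]
    · have : ∀ k, volume (Metric.ball (p k) (r/2)) = ENNReal.ofReal (r ^ d) := by
        intro k
        rw [Real.volume_pi_ball _ (by positivity)]
        simp [mul_div_cancel₀]
      simp only [this]
      rw [Finset.sum_const, Finset.card_range, nsmul_eq_mul, ENNReal.ofReal_mul (by positivity)]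
      simp
    · intro j hj k hk hjk
      refine Set.disjoint_left.2 fun x hx hy => hjk ?_
      exact hsame x x j (by simpa using hj) k (by simpa using hk) hx hy rfl
    · intro k _; exact Metric.isOpen_ball.measurableSet
  have hle : volume S ≤ volume (ZSpan.fundamentalDomain b) := by
    by_contra hlt
    push Not at hlt
    have hF := ZSpan.isAddFundamentalDomain' b volume
    haveI : Countable (Submodule.span ℤ (Set.range b)).toAddSubgroup :=
      inferInstanceAs (Countable (Submodule.span ℤ (Set.range b)))
    obtain ⟨x, y, hxy, hnd⟩ := exists_pair_mem_lattice_not_disjoint_vadd hF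
      (MeasurableSet.nullMeasurableSet
        (Finset.measurableSet_biUnion _ fun k _ => Metric.isOpen_ball.measurableSet)) hlt
    obtain ⟨u, ⟨v, hv, rfl⟩, ⟨w, hw, hvw⟩⟩ := Set.not_disjoint_iff.1 hnd
    have hvw : (y : Fin d → ℝ) + w = x + v := hvw
    have hx : (x : Fin d → ℝ) ∈ L := x.2
    have hy : (y : Fin d → ℝ) ∈ L := y.2
    simp only [hS, Finset.mem_range, mem_iUnion, exists_prop] at hv hw
    obtain ⟨j, hj, hv⟩ := hv
    obtain ⟨k, hk, hw⟩ := hw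
    have hgg : g v = g w := by rw [← hinv v x hx, ← hinv w y hy, hvw]
    have := hsame v w j hj k hk hv hw hgg
    subst this
    have h1 : dist v w < r := by
      have := dist_triangle_right v w (p j)
      have h1 : dist v (p j) < r/2 := hv
      have h2 : dist w (p j) < r/2 := hw
      linarith
    have h2 : (y : Fin d → ℝ) - x = v - w := by
      rw [sub_eq_sub_iff_add_eq_add, hvw, add_comm]
    have h3 := hmin _ (L.sub_mem hy hx) (fun h => hxy (Subtype.ext (sub_eq_zero.1 h).symm))
    rw [h2, ← dist_eq_norm] at h3
    linarith
  refine le_trans ?_ hle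
  rw [hvol]
  apply ENNReal.ofReal_le_ofReal
  have : ρ / r ≤ K := by
    rw [hK]; push_cast; exact (Nat.lt_floor_add_one _).le
  gcongr

/-- The box with centre `m` and side lengths `s`, avoiding the lattice, has volume bounded. -/
theorem box_aux {d : ℕ} (hd : 1 ≤ d) (T : Matrix (Fin d) (Fin d) ℝ) (hT : IsUnit T.det)
    (hN : 0 < Nm (latticeOf T)) (m s : Fin d → ℝ) (hs : ∀ i, 0 < s i)
    (hemp : ∀ z ∈ latticeOf T, ∃ i, s i / 2 ≤ |m i - z i|) :
    ∏ i, s i ≤ (2 * |T.det|) ^ d / Nm (latticeOf T) ^ (d - 1) := by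
  set N := Nm (latticeOf T) with hNdef
  set V := ∏ i, s i with hV
  have hVpos : 0 < V := Finset.prod_pos fun i _ => hs i
  have hNle : ∀ z ∈ latticeOf T, z ≠ 0 → N ≤ ∏ j, |z j| := by
    intro z hz hz0
    refine csInf_le ⟨0, ?_⟩ ⟨z, hz, hz0, rfl⟩
    rintro p ⟨w, -, -, rfl⟩
    exact Finset.prod_nonneg fun _ _ => abs_nonneg _
  set T' : Matrix (Fin d) (Fin d) ℝ := Matrix.diagonal (fun i => (s i)⁻¹) * T with hT'
  have hdet : T'.det = V⁻¹ * T.det := by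
    rw [hT', Matrix.det_mul, Matrix.det_diagonal, Finset.prod_inv_distrib]
  have hTne : T.det ≠ 0 := hT.ne_zero
  have hU : IsUnit T' := by
    rw [Matrix.isUnit_iff_isUnit_det, hdet]
    exact (mul_ne_zero (inv_ne_zero hVpos.ne') hTne).isUnit
  haveI : Nonempty (Fin d) := ⟨⟨0, hd⟩⟩
  let b := basisOfLinearIndependentOfCardEqFinrank
    (Matrix.linearIndependent_cols_of_isUnit hU) (by simp)
  have hb : ⇑b = T'.col := coe_basisOfLinearIndependentOfCardEqFinrank _ _
  have hvolb : volume (ZSpan.fundamentalDomain b) = ENNReal.ofReal (V⁻¹ * |T.det|) := by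
    rw [ZSpan.volume_fundamentalDomain, hb]
    have : (Matrix.of T'.col) = T'.transpose := by ext i j; rfl
    rw [this, Matrix.det_transpose, hdet, abs_mul, abs_of_pos (inv_pos.2 hVpos)]
  have hmem : ∀ w ∈ Submodule.span ℤ (Set.range b), ∃ z ∈ latticeOf T, ∀ i, w i = z i / s i := by
    intro w hw
    rw [Submodule.mem_span_range_iff_exists_fun] at hw
    obtain ⟨a, rfl⟩ := hw
    refine ⟨_, ⟨a, rfl⟩, fun i => ?_⟩
    simp [hb, hT', Matrix.mulVec, dotProduct, Finset.sum_apply, Matrix.col, Matrix.diagonal_mul,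
      Finset.sum_div]
    refine Finset.sum_congr rfl fun j _ => ?_
    ring
  have hdne : d ≠ 0 := by omega
  set r : ℝ := (N / V) ^ ((d : ℝ)⁻¹) with hrdef
  have hr : 0 < r := by positivity
  have hrd : r ^ d = N / V := Real.rpow_inv_natCast_pow (by positivity) hdne
  have hmin : ∀ w ∈ Submodule.span ℤ (Set.range b), w ≠ 0 → r ≤ ‖w‖ := by
    intro w hw hw0
    obtain ⟨z, hz, hzw⟩ := hmem w hw
    have hz0 : z ≠ 0 := by
      rintro rfl
      exact hw0 (funext fun i => by simp [hzw i])
    have h1 : ∏ j, |w j| = (∏ j, |z j|) / V := by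
      rw [hV, ← Finset.prod_div_distrib]
      refine Finset.prod_congr rfl fun j _ => ?_
      rw [hzw j, abs_div, abs_of_pos (hs j)]
    have h2 : ∏ j, |w j| ≤ ‖w‖ ^ d := by
      calc ∏ j, |w j| ≤ ∏ _j : Fin d, ‖w‖ :=
            Finset.prod_le_prod (fun _ _ => abs_nonneg _) fun j _ => norm_le_pi_norm w j
        _ = ‖w‖ ^ d := by simp
    have h3 : r ^ d ≤ ‖w‖ ^ d := by
      rw [hrd]
      refine le_trans ?_ h2
      rw [h1]
      have := hNle z hz hz0
      gcongr
    exact le_of_pow_le_pow_left₀ hdne (norm_nonneg _) h3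
  have key := covering_aux b r (1 / 2) hr (by norm_num) hmin (fun i => m i / s i) (by
    intro w hw
    obtain ⟨z, hz, hzw⟩ := hmem w hw
    obtain ⟨i, hi⟩ := hemp z hz
    refine le_trans ?_ (dist_le_pi_dist _ _ i)
    rw [Real.dist_eq, hzw i, ← sub_div, abs_div, abs_of_pos (hs i), le_div_iff₀ (hs i)]
    linarith)
  rw [hvolb, ENNReal.ofReal_le_ofReal_iff (by positivity)] at key
  obtain ⟨e, rfl⟩ : ∃ e, d = e + 1 := ⟨d - 1, by omega⟩
  have h1 : r ^ e ≤ 2 * |T.det| / V := by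
    have : 1 / 2 / r * r ^ (e + 1) = r ^ e / 2 := by
      rw [pow_succ]; field_simp
    rw [this] at key
    have h : V⁻¹ * |T.det| = (2 * |T.det| / V) / 2 := by field_simp
    rw [h] at key
    linarith
  have h2 : (N / V) ^ e ≤ (2 * |T.det| / V) ^ (e + 1) := by
    calc (N / V) ^ e = (r ^ e) ^ (e + 1) := by rw [← hrd, ← pow_mul, ← pow_mul, mul_comm]
      _ ≤ _ := by gcongr
  rw [div_pow, div_pow, div_le_div_iff₀ (by positivity) (by positivity)] at h2
  rw [le_div_iff₀ (by positivity)]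
  simp only [Nat.add_sub_cancel]
  have hVe : 0 < V ^ e := by positivity
  refine le_of_mul_le_mul_right ?_ hVe
  calc V * N ^ e * V ^ e = N ^ e * V ^ (e + 1) := by ring
    _ ≤ _ := h2

/-- For every `d ≥ 1` there is a bound, depending only on `d`, `det Λ` and `Nm Λ`,
on the volume of empty axis-parallel boxes of an admissible lattice. -/
theorem dispStar_le_of_admissible (d : ℕ) (hd : 1 ≤ d) :
    ∃ D : ℝ → ℝ → ℝ, ∀ T : Matrix (Fin d) (Fin d) ℝ, IsUnit T.det →
      ∀ Λ : Set (Fin d → ℝ), Λ = latticeOf T → 0 < Nm Λ →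
        dispStar Λ ≤ ENNReal.ofReal (D |T.det| (Nm Λ)) := by
  refine ⟨fun a n => (2 * a) ^ d / n ^ (d - 1), ?_⟩
  rintro T hT _ rfl hN
  refine iSup₂_le ?_
  rintro B ⟨⟨I, hI, rfl⟩, hemp⟩
  rw [volume_pi_pi]
  by_cases h0 : ∃ i, volume (I i) = 0
  · obtain ⟨i, hi⟩ := h0
    rw [Finset.prod_eq_zero (Finset.mem_univ i) hi]
    exact zero_le
  push Not at h0
  have hsub : ∀ i, I i ⊆ Set.Icc (sInf (I i)) (sSup (I i)) := fun i x hx =>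
    ⟨csInf_le (hI i).1.bddBelow hx, le_csSup (hI i).1.bddAbove hx⟩
  have hvol : ∀ i, volume (I i) ≤ ENNReal.ofReal (sSup (I i) - sInf (I i)) := fun i =>
    (measure_mono (hsub i)).trans (by rw [Real.volume_Icc])
  have hs : ∀ i, 0 < sSup (I i) - sInf (I i) := by
    intro i
    by_contra h
    have := hvol i
    rw [ENNReal.ofReal_of_nonpos (not_lt.1 h)] at this
    exact h0 i (le_antisymm this zero_le)
  have hne : ∀ i, (I i).Nonempty := fun i => nonempty_of_measure_ne_zero (h0 i)
  calc ∏ i, volume (I i) ≤ ∏ i, ENNReal.ofReal (sSup (I i) - sInf (I i)) :=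
        Finset.prod_le_prod' fun i _ => hvol i
    _ = ENNReal.ofReal (∏ i, (sSup (I i) - sInf (I i))) :=
        (ENNReal.ofReal_prod_of_nonneg fun i _ => (hs i).le).symm
    _ ≤ _ := by
      refine ENNReal.ofReal_le_ofReal (box_aux hd T hT hN
        (fun i => (sSup (I i) + sInf (I i)) / 2) _ hs ?_)
      intro z hz
      by_contra hcon
      push Not at hcon
      have : z ∈ Set.univ.pi I ∩ latticeOf T := by
        refine ⟨fun i _ => ?_, hz⟩
        have h := abs_lt.1 (hcon i)
        obtain ⟨x, hx, hxz⟩ := exists_lt_of_csInf_lt (hne i) (b := z i) (by linarith)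
        obtain ⟨y, hy, hyz⟩ := exists_lt_of_lt_csSup (hne i) (b := z i) (by linarith)
        exact (hI i).2.out hx hy ⟨hxz.le, hyz.le⟩
      rw [hemp] at this
      exact this
end
end

section
/- Let Λ ⊂ ℝ^d be an admissible lattice and let D_Λ be a finite upper bound for disp*(Λ). Then for every t ∈ ℝ^d with all coordinates nonzero, the dispersion of the point set (t^{-1}Λ) ∩ [0,1]^d inside the unit cube satisfies disp((t^{-1}Λ) ∩ [0,1]^d) ≤ D_Λ / n(t). -/
open MeasureTheory Set ENNReal

noncomputable section

/-- Dispersion bound for dilated admissible lattices restricted to the unit cube. -/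
theorem disp_dilate_le (d : ℕ) (Λ : Set (Fin d → ℝ)) (hΛ : IsLattice Λ)
    (hadm : 0 < Nm Λ) (D : ℝ) (hD : dispStar Λ ≤ ENNReal.ofReal D)
    (t : Fin d → ℝ) (ht : ∀ i, t i ≠ 0) :
    disp (dilate t Λ ∩ unitCube d) ≤ ENNReal.ofReal (D / ∏ i, |t i|) := by
  have hn : 0 < ∏ i, |t i| := Finset.prod_pos fun i _ => abs_pos.mpr (ht i)
  rw [ENNReal.ofReal_div_of_pos hn]
  unfold disp
  refine iSup₂_le ?_
  rintro B ⟨⟨I, hI, rfl⟩, hB⟩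
  rw [ENNReal.le_div_iff_mul_le (Or.inl (by simpa using hn)) (Or.inl ENNReal.ofReal_ne_top)]
  refine le_trans ?_ hD
  let J : Fin d → Set ℝ := fun i => (fun x => (t i)⁻¹ * x) ⁻¹' I i
  have hvol : volume (Set.univ.pi J) = volume (Set.univ.pi I) * ENNReal.ofReal (∏ i, |t i|) := by
    rw [volume_pi_pi, volume_pi_pi, ENNReal.ofReal_prod_of_nonneg (fun i _ => abs_nonneg _),
      ← Finset.prod_mul_distrib]
    refine Finset.prod_congr rfl fun i _ => ?_
    simp only [J]
    rw [Real.volume_preimage_mul_left (inv_ne_zero (ht i)), inv_inv, mul_comm]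
  rw [← hvol]
  unfold dispStar
  refine le_iSup₂_of_le (Set.univ.pi J) ⟨⟨J, fun i => ⟨?_, ?_⟩, rfl⟩, ?_⟩ le_rfl
  · have hc : IsCompact ((fun x => t i * x) '' Set.Icc (0 : ℝ) 1) :=
      isCompact_Icc.image (by fun_prop)
    refine hc.isBounded.subset fun x hx => ⟨(t i)⁻¹ * x, (hI i).1 hx, ?_⟩
    exact mul_inv_cancel_left₀ (ht i) x
  · rcases le_total 0 (t i)⁻¹ with h | h
    · exact (hI i).2.preimage_mono fun x y hxy => mul_le_mul_of_nonneg_left hxy h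
    · exact (hI i).2.preimage_anti fun x y hxy => mul_le_mul_of_nonpos_left hxy h
  · rw [Set.eq_empty_iff_forall_notMem] at hB ⊢
    rintro z ⟨hz, hzΛ⟩
    have hz' : ∀ i, z i / t i ∈ I i := fun i => by
      have := hz i (Set.mem_univ i)
      simpa [J, div_eq_inv_mul] using this
    exact hB (fun i => z i / t i) ⟨fun i _ => hz' i, ⟨z, hzΛ, rfl⟩, fun i _ => (hI i).1 (hz' i)⟩
end
end

section
/- Let Λ ⊂ ℝ^d be an admissible lattice. Then there is a constant C_Λ < ∞, depending on Λ only by means of det(Λ) and Nm(Λ), such that for every N ∈ ℕ with N ≥ 1 there exists t_N ∈ ℝ^d with positive coordinates such that the point set P_N := (t_N^{-1}Λ) ∩ [0,1]^d has exactly N elements and satisfies disp(P_N) ≤ C_Λ / N. -/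
open MeasureTheory Set ENNReal

noncomputable section

open Matrix in
lemma covering_aux_s2 {d : ℕ} (T : Matrix (Fin d) (Fin d) ℝ) (hT : IsUnit T.det) (r : ℝ) (hr : 0 < r)
    (hmin : ∀ z ∈ latticeOf T, z ≠ 0 → r ≤ ‖z‖) (n : ℕ) (hn : |T.det| < n * r ^ d)
    (x : Fin d → ℝ) : ∃ z ∈ latticeOf T, dist x z < n * r := by
  classical
  by_contra hcon
  push Not at hcon
  have hTt : IsUnit (Tᵀ) := by
    rw [Matrix.isUnit_iff_isUnit_det, Matrix.det_transpose]; exact hT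
  have hli : LinearIndependent ℝ (fun i => Tᵀ i) := Matrix.linearIndependent_rows_iff_isUnit.mpr hTt
  let b : Module.Basis (Fin d) ℝ (Fin d → ℝ) :=
    basisOfLinearIndependentOfCardEqFinrank' _ hli (by simp)
  have hb : ∀ i, b i = Tᵀ i := by intro i; simp [b]
  have hmem : ∀ z, z ∈ Submodule.span ℤ (Set.range b) ↔ z ∈ latticeOf T := by
    intro z
    rw [Submodule.mem_span_range_iff_exists_fun]
    have : ∀ c : Fin d → ℤ, ∑ i, c i • b i = T.mulVec fun i => (c i : ℝ) := by
      intro c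
      ext j
      simp [hb, Matrix.mulVec, dotProduct, mul_comm]
    simp only [this]
    rfl
  let L := Submodule.span ℤ (Set.range b)
  have h0 : (0 : Fin d → ℝ) ∈ (L : Set (Fin d → ℝ)) := L.zero_mem
  have hne : (L : Set (Fin d → ℝ)).Nonempty := ⟨0, h0⟩
  let f : (Fin d → ℝ) → ℝ := fun y => Metric.infDist y (L : Set (Fin d → ℝ))
  have hfx : n * r ≤ f x := by
    rw [Metric.le_infDist hne]
    intro y hy
    exact hcon y ((hmem y).1 hy)
  have hfadd : ∀ y, ∀ z ∈ L, f y ≤ f (z + y) := by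
    intro y z hz
    rw [Metric.le_infDist hne]
    intro w hw
    have : w - z ∈ L := L.sub_mem hw hz
    refine (Metric.infDist_le_dist_of_mem (show w - z ∈ (L : Set (Fin d → ℝ)) from this)).trans ?_
    rw [dist_eq_norm, dist_eq_norm]
    apply le_of_eq; congr 1; abel
  have hlip : ∀ y z, f y ≤ f z + dist y z := fun y z => Metric.infDist_le_infDist_add_dist
  have hex : ∀ k : Fin n, ∃ y, f y = k * r := by
    intro k
    have hpc : IsPreconnected (Set.univ : Set (Fin d → ℝ)) := isPreconnected_univ
    have hc : ContinuousOn f Set.univ := (Metric.continuous_infDist_pt _).continuousOn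
    have := hpc.intermediate_value (Set.mem_univ (0 : Fin d → ℝ)) (Set.mem_univ x) hc
    have hk : (k * r : ℝ) ∈ Set.Icc (f 0) (f x) := by
      constructor
      · have : f 0 = 0 := Metric.infDist_zero_of_mem h0
        rw [this]; positivity
      · refine le_trans ?_ hfx
        have : (k : ℝ) ≤ n := by exact_mod_cast k.2.le
        gcongr
    obtain ⟨y, -, hy⟩ := this hk
    exact ⟨y, hy⟩
  choose y hy using hex
  let s : Set (Fin d → ℝ) := ⋃ k : Fin n, Metric.ball (y k) (r / 2)
  -- separation
  have hsep : ∀ k l : Fin n, ∀ z ∈ L, dist (z + y k) (y l) < r → k = l ∧ z = 0 := by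
    intro k l z hz hd
    have hdl := hlip (y l) (z + y k)
    have h1 := hlip (z + y k) (y l)
    have h2 := hfadd (y k) z hz
    have h3 := hfadd (z + y k) (-z) (L.neg_mem hz)
    rw [neg_add_cancel_left] at h3
    rw [dist_comm] at hdl
    rw [hy] at *
    have h4 : ((k : ℕ) : ℝ) < l + 1 := by
      by_contra hh
      push Not at hh
      nlinarith
    have h5 : ((l : ℕ) : ℝ) < k + 1 := by
      by_contra hh
      push Not at hh
      nlinarith
    have hkl : k = l := by
      ext
      have h4' : (k : ℕ) < l + 1 := by exact_mod_cast h4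
      have h5' : (l : ℕ) < k + 1 := by exact_mod_cast h5
      omega
    refine ⟨hkl, ?_⟩
    subst hkl
    by_contra hz0
    have := hmin z ((hmem z).1 hz) hz0
    rw [dist_eq_norm, add_sub_cancel_right] at hd
    linarith
  have hvol : volume s = ENNReal.ofReal (n * r ^ d) := by
    rw [measure_iUnion]
    · simp only [Real.volume_pi_ball _ (half_pos hr)]
      simp only [tsum_fintype, Finset.sum_const, Finset.card_univ, Fintype.card_fin, nsmul_eq_mul]
      rw [ENNReal.ofReal_mul (by positivity), ENNReal.ofReal_natCast]
      congr 3
      ring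
    · intro k l hkl
      rw [Function.onFun, Set.disjoint_left]
      intro w hw hw'
      apply hkl
      refine (hsep k l 0 L.zero_mem ?_).1
      rw [zero_add]
      have := dist_triangle_left (y k) (y l) w
      rw [Metric.mem_ball] at hw hw'
      linarith
    · intro k; exact measurableSet_ball
  have hF := ZSpan.isAddFundamentalDomain' b (volume : Measure (Fin d → ℝ))
  have hFv : volume (ZSpan.fundamentalDomain b) = ENNReal.ofReal |T.det| := by
    rw [ZSpan.volume_fundamentalDomain]
    have : Matrix.of b = Tᵀ := by ext i j; simp [hb]
    rw [this, Matrix.det_transpose]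
  have hlt : volume (ZSpan.fundamentalDomain b) < volume s := by
    rw [hFv, hvol]
    exact (ENNReal.ofReal_lt_ofReal_iff_of_nonneg (abs_nonneg _)).2 hn
  have : Countable (L.toAddSubgroup) := inferInstanceAs (Countable L)
  obtain ⟨u, v, huv, hdis⟩ := MeasureTheory.exists_pair_mem_lattice_not_disjoint_vadd
    (L := L.toAddSubgroup) hF (MeasurableSet.iUnion fun k => measurableSet_ball).nullMeasurableSet hlt
  rw [Set.not_disjoint_iff] at hdis
  obtain ⟨w, hw1, hw2⟩ := hdis
  obtain ⟨p, hp, hpw⟩ := hw1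
  obtain ⟨q, hq, hqw⟩ := hw2
  obtain ⟨k, hk⟩ := Set.mem_iUnion.1 hp
  obtain ⟨l, hl⟩ := Set.mem_iUnion.1 hq
  have e : (u : Fin d → ℝ) + p = (v : Fin d → ℝ) + q := by
    exact hpw.trans hqw.symm
  have := hsep k l ((u : Fin d → ℝ) - v) (L.sub_mem u.2 v.2) (by
    rw [Metric.mem_ball, dist_eq_norm] at hk hl
    rw [dist_eq_norm]
    have e2 : (u : Fin d → ℝ) - v + y k - y l = (q - y l) - (p - y k) := by
      have : (u : Fin d → ℝ) - v = q - p := by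
        rw [sub_eq_sub_iff_add_eq_add, e, add_comm]
      rw [this]; abel
    rw [e2]
    have := norm_sub_le (q - y l) (p - y k)
    linarith)
  exact huv (Subtype.ext (sub_eq_zero.1 this.2))

lemma Nm_le_prod {d : ℕ} {Λ : Set (Fin d → ℝ)} {z : Fin d → ℝ} (hz : z ∈ Λ) (h0 : z ≠ 0) :
    Nm Λ ≤ ∏ j, |z j| := by
  apply csInf_le
  · refine ⟨0, ?_⟩
    rintro p ⟨w, -, -, rfl⟩
    exact Finset.prod_nonneg fun _ _ => abs_nonneg _
  · exact ⟨z, hz, h0, rfl⟩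

lemma box_hit {d : ℕ} (hd : 1 ≤ d) (T : Matrix (Fin d) (Fin d) ℝ) (hT : IsUnit T.det)
    (hN : 0 < Nm (latticeOf T)) (n : ℕ) (hn : |T.det| < n * Nm (latticeOf T))
    (a b : Fin d → ℝ) (hab : ∀ i, a i < b i)
    (hV : (2 * n) ^ d * Nm (latticeOf T) < ∏ i, (b i - a i)) :
    ∃ z ∈ latticeOf T, ∀ i, a i < z i ∧ z i < b i := by
  have hl : ∀ i, 0 < b i - a i := fun i => sub_pos.2 (hab i)
  set V := ∏ i, (b i - a i) with hVdef
  have hVpos : 0 < V := Finset.prod_pos fun i _ => hl i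
  set M := Nm (latticeOf T) with hM
  have hd0 : d ≠ 0 := by omega
  let r : ℝ := (M / V) ^ ((d : ℝ)⁻¹)
  have hr : 0 < r := Real.rpow_pos_of_pos (div_pos hN hVpos) _
  have hrd : r ^ d = M / V := Real.rpow_inv_natCast_pow (div_pos hN hVpos).le hd0
  let T' : Matrix (Fin d) (Fin d) ℝ := Matrix.diagonal (fun i => (b i - a i)⁻¹) * T
  have hdet : T'.det = V⁻¹ * T.det := by
    simp [T', Matrix.det_mul, Matrix.det_diagonal, hVdef, Finset.prod_inv_distrib]
  have hT' : IsUnit T'.det := by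
    rw [hdet]
    exact (isUnit_iff_ne_zero.2 (inv_ne_zero hVpos.ne')).mul hT
  have hmem : ∀ z ∈ latticeOf T', ∃ w ∈ latticeOf T, ∀ i, z i = (b i - a i)⁻¹ * w i := by
    rintro z ⟨c, rfl⟩
    refine ⟨_, ⟨c, rfl⟩, ?_⟩
    intro i
    simp only [T', ← Matrix.mulVec_mulVec, Matrix.mulVec_diagonal]
  have hmin : ∀ z ∈ latticeOf T', z ≠ 0 → r ≤ ‖z‖ := by
    intro z hz hz0
    obtain ⟨w, hw, hzw⟩ := hmem z hz
    have hw0 : w ≠ 0 := by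
      rintro rfl
      apply hz0
      ext i
      simp [hzw]
    have h1 := Nm_le_prod hw hw0
    have h2 : ∏ j, |z j| = (∏ j, |w j|) / V := by
      simp only [hzw, abs_mul, Finset.prod_mul_distrib]
      rw [div_eq_inv_mul, hVdef, ← Finset.prod_inv_distrib]
      congr 1
      exact Finset.prod_congr rfl fun i _ => abs_of_pos (inv_pos.2 (hl i))
    have h3 : ∏ j, |z j| ≤ ‖z‖ ^ d := by
      calc ∏ j, |z j| ≤ ∏ j : Fin d, ‖z‖ := by
            apply Finset.prod_le_prod
            · intros; positivity
            · intro j _; exact norm_le_pi_norm z j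
        _ = ‖z‖ ^ d := by simp
    apply le_of_pow_le_pow_left₀ hd0 (norm_nonneg _)
    rw [hrd]
    refine le_trans ?_ h3
    rw [h2]
    gcongr
  have hn' : |T'.det| < n * r ^ d := by
    rw [hdet, hrd, abs_mul, abs_of_pos (inv_pos.2 hVpos), ← mul_div_assoc, div_eq_inv_mul]
    gcongr
  obtain ⟨z, hz, hdist⟩ := covering_aux_s2 T' hT' r hr hmin n hn'
    (fun i => (a i + b i) / 2 / (b i - a i))
  have hnr : n * r < 1 / 2 := by
    have : (2 * n * r) ^ d < 1 ^ d := by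
      rw [mul_pow, hrd, one_pow, ← mul_div_assoc, div_lt_one hVpos]
      exact hV
    have := lt_of_pow_lt_pow_left₀ d zero_le_one this
    linarith
  obtain ⟨w, hw, hzw⟩ := hmem z hz
  refine ⟨w, hw, fun i => ?_⟩
  have h1 := (dist_le_pi_dist _ z i).trans_lt (hdist.trans hnr)
  rw [hzw, Real.dist_eq, div_eq_inv_mul, ← mul_sub, abs_mul, abs_of_pos (inv_pos.2 (hl i)),
    inv_mul_lt_iff₀ (hl i), abs_lt] at h1
  constructor <;> linarith [h1.1, h1.2]

def boxPts {d : ℕ} (Λ : Set (Fin d → ℝ)) (i0 : Fin d) (s : ℝ) : Set (Fin d → ℝ) :=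
  {z | z ∈ Λ ∧ ∀ i, 0 ≤ z i ∧ z i ≤ Function.update (fun _ => (1 : ℝ)) i0 s i}

lemma latticeOf_sub {d : ℕ} {T : Matrix (Fin d) (Fin d) ℝ} {z w : Fin d → ℝ}
    (hz : z ∈ latticeOf T) (hw : w ∈ latticeOf T) : z - w ∈ latticeOf T := by
  obtain ⟨c, rfl⟩ := hz
  obtain ⟨e, rfl⟩ := hw
  refine ⟨c - e, ?_⟩
  simp only
  rw [← Matrix.mulVec_sub]
  congr 1
  ext i
  simp

lemma latticeOf_zero {d : ℕ} {T : Matrix (Fin d) (Fin d) ℝ} : 0 ∈ latticeOf T :=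
  ⟨0, by ext i; simp [Matrix.mulVec, dotProduct]⟩

lemma boxPts_sep {d : ℕ} (T : Matrix (Fin d) (Fin d) ℝ) (i0 : Fin d) {s s' : ℝ}
    {z w : Fin d → ℝ} (hz : z ∈ boxPts (latticeOf T) i0 s) (hw : w ∈ boxPts (latticeOf T) i0 s')
    (hzw : z ≠ w) : Nm (latticeOf T) ≤ |z i0 - w i0| := by
  have h := Nm_le_prod (latticeOf_sub hz.1 hw.1) (sub_ne_zero.2 hzw)
  refine h.trans ?_
  rw [← Finset.mul_prod_erase _ _ (Finset.mem_univ i0)]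
  have : ∏ x ∈ Finset.univ.erase i0, |(z - w) x| ≤ 1 := by
    apply Finset.prod_le_one
    · intros; positivity
    · intro i hi
      have hi' := Finset.ne_of_mem_erase hi
      have h1 := hz.2 i
      have h2 := hw.2 i
      rw [Function.update_of_ne hi'] at h1 h2
      rw [Pi.sub_apply, abs_le]
      constructor <;> linarith [h1.1, h1.2, h2.1, h2.2]
  calc _ ≤ |(z - w) i0| * 1 := by gcongr
    _ = _ := by simp

lemma boxPts_finite {d : ℕ} (T : Matrix (Fin d) (Fin d) ℝ) (hN : 0 < Nm (latticeOf T))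
    (i0 : Fin d) {s : ℝ} (hs : 0 ≤ s) : (boxPts (latticeOf T) i0 s).Finite ∧
      ((boxPts (latticeOf T) i0 s).ncard : ℝ) ≤ s / Nm (latticeOf T) + 1 := by
  set M := Nm (latticeOf T) with hM
  let f : (Fin d → ℝ) → ℕ := fun z => ⌊z i0 / M⌋₊
  have hmaps : ∀ z ∈ boxPts (latticeOf T) i0 s,
      f z ∈ ((Finset.range (⌊s / M⌋₊ + 1) : Finset ℕ) : Set ℕ) := by
    intro z hz
    have h := (hz.2 i0).2
    rw [Function.update_self] at h
    rw [Finset.coe_range, Set.mem_Iio, Nat.lt_succ_iff]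
    apply Nat.floor_le_floor
    gcongr
  have hinj : Set.InjOn f (boxPts (latticeOf T) i0 s) := by
    intro z hz w hw hf
    by_contra hne
    have h := boxPts_sep T i0 hz hw hne
    have hz0 : 0 ≤ z i0 / M := div_nonneg (hz.2 i0).1 hN.le
    have hw0 : 0 ≤ w i0 / M := div_nonneg (hw.2 i0).1 hN.le
    have h1 := Nat.floor_le hz0
    have h2 := Nat.floor_le hw0
    have h3 := Nat.lt_floor_add_one (z i0 / M)
    have h4 := Nat.lt_floor_add_one (w i0 / M)
    have hf' : ((⌊z i0 / M⌋₊ : ℕ) : ℝ) = ⌊w i0 / M⌋₊ := by exact_mod_cast hf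
    have h5 : |z i0 / M - w i0 / M| < 1 := by
      rw [abs_lt]; constructor <;> linarith
    rw [← sub_div, abs_div, abs_of_pos hN, div_lt_one hN] at h5
    linarith
  refine ⟨Set.Finite.of_injOn hmaps hinj (Finset.finite_toSet _), ?_⟩
  have h := Set.ncard_le_ncard_of_injOn f hmaps hinj (Finset.finite_toSet _)
  rw [Set.ncard_coe_finset, Finset.card_range] at h
  have h' : ((boxPts (latticeOf T) i0 s).ncard : ℝ) ≤ ⌊s / M⌋₊ + 1 := by exact_mod_cast h
  have := Nat.floor_le (div_nonneg hs hN.le)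
  linarith

lemma boxPts_mono {d : ℕ} (Λ : Set (Fin d → ℝ)) (i0 : Fin d) {z : Fin d → ℝ} {s s' : ℝ}
    (hz : z ∈ boxPts Λ i0 s) (h : z i0 ≤ s') : z ∈ boxPts Λ i0 s' := by
  refine ⟨hz.1, fun i => ⟨(hz.2 i).1, ?_⟩⟩
  by_cases hi : i = i0
  · subst hi; simpa using h
  · have := (hz.2 i).2
    rw [Function.update_of_ne hi] at this ⊢
    exact this

lemma boxPts_exists {d : ℕ} (hd : 1 ≤ d) (T : Matrix (Fin d) (Fin d) ℝ) (hT : IsUnit T.det)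
    (hN : 0 < Nm (latticeOf T)) (i0 : Fin d) (N : ℕ) (h1 : 1 ≤ N) :
    ∃ s, 0 < s ∧ (boxPts (latticeOf T) i0 s).ncard = N := by
  induction N, h1 using Nat.le_induction with
  | base =>
    refine ⟨Nm (latticeOf T) / 2, by positivity, ?_⟩
    rw [Set.ncard_eq_one]
    have h0 : (0 : Fin d → ℝ) ∈ boxPts (latticeOf T) i0 (Nm (latticeOf T) / 2) := by
      refine ⟨latticeOf_zero, fun i => ⟨le_rfl, ?_⟩⟩
      by_cases hi : i = i0
      · subst hi; simp; positivity
      · rw [Function.update_of_ne hi]; simp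
    refine ⟨0, Set.eq_singleton_iff_unique_mem.2 ⟨h0, fun z hz => ?_⟩⟩
    by_contra hne
    have h := boxPts_sep T i0 hz h0 hne
    have h2 := hz.2 i0
    rw [Function.update_self] at h2
    rw [Pi.zero_apply, sub_zero, abs_of_nonneg h2.1] at h
    linarith [h2.2]
  | succ N h1 ih =>
    obtain ⟨s, hs, hcard⟩ := ih
    set M := Nm (latticeOf T) with hM
    obtain ⟨n, hn⟩ := exists_nat_gt (|T.det| / M)
    rw [div_lt_iff₀ hN] at hn
    let K : ℝ := (2 * n) ^ d * M
    have hK : 0 ≤ K := by positivity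
    obtain ⟨w, hw, hwb⟩ := box_hit hd T hT hN n hn (Function.update (fun _ => 0) i0 s)
      (Function.update (fun _ => 1) i0 (s + (K + 1))) (by
        intro i
        by_cases hi : i = i0
        · subst hi; simp; linarith
        · simp [Function.update_of_ne hi]) (by
        rw [← Finset.mul_prod_erase _ _ (Finset.mem_univ i0)]
        rw [Finset.prod_eq_one]
        · simp only [Function.update_self]
          show K < _
          linarith
        · intro i hi
          have hi' := Finset.ne_of_mem_erase hi
          simp [Function.update_of_ne hi'])
    have hws := (hwb i0).1
    rw [Function.update_self] at hws
    have hwS : w ∈ boxPts (latticeOf T) i0 (s + (K + 1)) := by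
      refine ⟨hw, fun i => ⟨?_, (hwb i).2.le⟩⟩
      refine le_trans ?_ (hwb i).1.le
      by_cases hi : i = i0
      · subst hi; simp [hs.le]
      · simp [Function.update_of_ne hi]
    let A := {z ∈ boxPts (latticeOf T) i0 (s + (K + 1)) | s < z i0}
    have hAf : A.Finite := (boxPts_finite T hN i0 (by positivity)).1.subset (Set.sep_subset _ _)
    obtain ⟨v, hvA, hvmin⟩ := Set.exists_min_image A (fun z => z i0) hAf ⟨w, hwS, hws⟩
    have hvs : s < v i0 := hvA.2
    have hvle : v i0 ≤ s + (K + 1) := by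
      have := (hvA.1.2 i0).2
      rwa [Function.update_self] at this
    refine ⟨v i0, hs.trans hvs, ?_⟩
    have heq : boxPts (latticeOf T) i0 (v i0) = insert v (boxPts (latticeOf T) i0 s) := by
      ext z
      rw [Set.mem_insert_iff]
      constructor
      · intro hz
        have hzv := (hz.2 i0).2
        rw [Function.update_self] at hzv
        by_cases hzs : z i0 ≤ s
        · exact Or.inr (boxPts_mono _ _ hz hzs)
        · left
          push Not at hzs
          by_contra hne
          have hzA : z ∈ A := ⟨boxPts_mono _ _ hz (hzv.trans hvle), hzs⟩
          have h3 := hvmin z hzA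
          have h4 := boxPts_sep T i0 hz hvA.1 hne
          have h5 : z i0 = v i0 := le_antisymm hzv h3
          rw [h5, sub_self, abs_zero] at h4
          linarith
      · rintro (rfl | hz)
        · exact boxPts_mono _ _ hvA.1 le_rfl
        · have := (hz.2 i0).2
          rw [Function.update_self] at this
          exact boxPts_mono _ _ hz (this.trans hvs.le)
    rw [heq, Set.ncard_insert_of_notMem _ (boxPts_finite T hN i0 hs.le).1, hcard]
    intro hv
    have := (hv.2 i0).2
    rw [Function.update_self] at this
    linarith

lemma ordConnected_aux {I : Set ℝ} (hI : I.OrdConnected) (h01 : I ⊆ Set.Icc 0 1)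
    (hne : I.Nonempty) :
    0 ≤ sInf I ∧ sSup I ≤ 1 ∧ Set.Ioo (sInf I) (sSup I) ⊆ I ∧
      volume I ≤ ENNReal.ofReal (sSup I - sInf I) := by
  have hba : BddAbove I := ⟨1, fun x hx => (h01 hx).2⟩
  have hbb : BddBelow I := ⟨0, fun x hx => (h01 hx).1⟩
  refine ⟨le_csInf hne fun x hx => (h01 hx).1, csSup_le hne fun x hx => (h01 hx).2, ?_, ?_⟩
  · rintro x ⟨hx1, hx2⟩
    obtain ⟨a, ha, hax⟩ := exists_lt_of_csInf_lt hne hx1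
    obtain ⟨b, hb, hbx⟩ := exists_lt_of_lt_csSup hne hx2
    exact hI.out ha hb ⟨hax.le, hbx.le⟩
  · rw [← Real.volume_Icc]
    exact measure_mono fun x hx => ⟨csInf_le hbb hx, le_csSup hba hx⟩

/-- For an admissible lattice, suitably dilated copies give `N`-point sets in the
unit cube with dispersion of order `1/N`; the constant depends on the lattice only
through `det Λ` and `Nm Λ`. -/
theorem exists_dilation_card_eq_and_disp_le (d : ℕ) (hd : 1 ≤ d) :
    ∃ C : ℝ → ℝ → ℝ, ∀ T : Matrix (Fin d) (Fin d) ℝ, IsUnit T.det →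
      ∀ Λ : Set (Fin d → ℝ), Λ = latticeOf T → 0 < Nm Λ →
        ∀ N : ℕ, 1 ≤ N → ∃ t : Fin d → ℝ, (∀ i, 0 < t i) ∧
          (dilate t Λ ∩ unitCube d).ncard = N ∧
          disp (dilate t Λ ∩ unitCube d) ≤ ENNReal.ofReal (C |T.det| (Nm Λ) / N) := by
  refine ⟨fun D M => 2 * (2 * ((⌊D / M⌋₊ + 1 : ℕ) : ℝ)) ^ d, ?_⟩
  rintro T hT Λ rfl hN N h1
  set M := Nm (latticeOf T) with hM
  set n : ℕ := ⌊|T.det| / M⌋₊ + 1 with hndef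
  have hn : |T.det| < n * M := by
    rw [← div_lt_iff₀ hN, hndef]
    push_cast
    exact Nat.lt_floor_add_one _
  let i0 : Fin d := ⟨0, hd⟩
  obtain ⟨s, hs, hcard⟩ := boxPts_exists hd T hT hN i0 N h1
  let t : Fin d → ℝ := Function.update (fun _ => (1 : ℝ)) i0 s
  have ht : ∀ i, 0 < t i := by
    intro i
    by_cases hi : i = i0
    · simp [t, hi, hs]
    · simp [t, Function.update_of_ne hi]
  have htprod : ∏ i, t i = s := by
    rw [← Finset.mul_prod_erase _ _ (Finset.mem_univ i0), Finset.prod_eq_one]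
    · simp [t]
    · intro i hi
      simp [t, Function.update_of_ne (Finset.ne_of_mem_erase hi)]
  have hset : dilate t (latticeOf T) ∩ unitCube d =
      (fun z i => z i / t i) '' boxPts (latticeOf T) i0 s := by
    ext p
    constructor
    · rintro ⟨⟨z, hz, rfl⟩, hc⟩
      refine ⟨z, ⟨hz, fun i => ?_⟩, rfl⟩
      have := hc i (Set.mem_univ i)
      rw [Set.mem_Icc, le_div_iff₀ (ht i), div_le_one (ht i), zero_mul] at this
      exact this
    · rintro ⟨z, hz, rfl⟩
      refine ⟨⟨z, hz.1, rfl⟩, fun i _ => ?_⟩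
      rw [Set.mem_Icc, le_div_iff₀ (ht i), div_le_one (ht i), zero_mul]
      exact hz.2 i
  refine ⟨t, ht, ?_, ?_⟩
  · rw [hset, Set.ncard_image_of_injective, hcard]
    intro z w h
    ext i
    have := congrFun h i
    simp only at this
    exact (div_left_inj' (ht i).ne').1 this
  have hNpos : (0 : ℝ) < N := by exact_mod_cast h1
  have hn1 : (1 : ℝ) ≤ n := by rw [hndef]; push_cast; linarith [Nat.cast_nonneg (α := ℝ) ⌊|T.det| / M⌋₊]
  have hpow : (1 : ℝ) ≤ (2 * n) ^ d := one_le_pow₀ (by linarith)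
  have hcount := (boxPts_finite T hN i0 hs.le).2
  rw [hcard, ← hM] at hcount
  refine iSup₂_le fun B hB => ?_
  obtain ⟨⟨I, hI, rfl⟩, hempty⟩ := hB
  rw [volume_pi_pi]
  by_cases hne : ∀ i, (I i).Nonempty
  swap
  · push Not at hne
    obtain ⟨i, hi⟩ := hne
    rw [Finset.prod_eq_zero (Finset.mem_univ i) (by rw [hi]; simp)]
    exact zero_le
  have haux := fun i => ordConnected_aux (hI i).2 (hI i).1 (hne i)
  have hle : ∏ i, volume (I i) ≤ ∏ i, ENNReal.ofReal (sSup (I i) - sInf (I i)) :=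
    Finset.prod_le_prod' fun i _ => (haux i).2.2.2
  by_cases hlt : ∀ i, sInf (I i) < sSup (I i)
  swap
  · push Not at hlt
    obtain ⟨i, hi⟩ := hlt
    refine hle.trans ?_
    rw [Finset.prod_eq_zero (Finset.mem_univ i) (ENNReal.ofReal_of_nonpos (by linarith))]
    exact zero_le
  refine hle.trans ?_
  rw [← ENNReal.ofReal_prod_of_nonneg (fun i _ => by linarith [hlt i])]
  apply ENNReal.ofReal_le_ofReal
  set W := ∏ i, (sSup (I i) - sInf (I i)) with hW
  have hW1 : W ≤ 1 := Finset.prod_le_one (fun i _ => by linarith [hlt i])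
    (fun i _ => by linarith [(haux i).1, (haux i).2.1])
  have hWs : s * W ≤ (2 * n) ^ d * M := by
    by_contra hcon
    push Not at hcon
    obtain ⟨z, hz, hzb⟩ := box_hit hd T hT hN n hn (fun i => t i * sInf (I i))
      (fun i => t i * sSup (I i)) (fun i => mul_lt_mul_of_pos_left (hlt i) (ht i)) (by
        simp only [← mul_sub, Finset.prod_mul_distrib]
        rw [htprod]
        exact hcon)
    have hzI : ∀ i, z i / t i ∈ I i := by
      intro i
      apply (haux i).2.2.1
      rw [Set.mem_Ioo, lt_div_iff₀ (ht i), div_lt_iff₀ (ht i)]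
      have := hzb i
      constructor <;> linarith [this.1, this.2]
    have : (fun i => z i / t i) ∈ (∅ : Set (Fin d → ℝ)) := by
      rw [← hempty]
      exact ⟨fun i _ => hzI i, ⟨z, hz, rfl⟩, fun i _ => (hI i).1 (hzI i)⟩
    exact this
  rw [le_div_iff₀ hNpos]
  show W * N ≤ 2 * (2 * (n : ℝ)) ^ d
  have hW0 : 0 ≤ W := Finset.prod_nonneg fun i _ => by linarith [hlt i]
  have h6 : s / M * W ≤ (2 * n) ^ d := by
    rw [div_mul_eq_mul_div, div_le_iff₀ hN]; exact hWs
  nlinarith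
end
end

section
/- Let Λ ⊂ ℝ^d be an admissible lattice and let B = I_1 × ⋯ × I_d be an axis-parallel box of volume |B|. Then the number of lattice points in B satisfies #(Λ ∩ B) ≤ |B| / Nm(Λ) + 1; in particular Λ ∩ B is finite. -/
open MeasureTheory Set ENNReal

noncomputable section

theorem sep_aux (P N : ℝ) (a : ℝ) (hP : 0 ≤ P) (S : Finset ℝ) :
    (∀ x ∈ S, a ≤ x) → (∀ x ∈ S, ∀ y ∈ S, x ≠ y → N ≤ |x - y| * P) → S.Nonempty →
      ∃ x ∈ S, a * P + ((S.card : ℝ) - 1) * N ≤ x * P := by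
  induction S using Finset.induction_on_max with
  | empty => intro _ _ h; exact absurd h (by simp)
  | insert b S hb ih =>
    intro h1 h2 _
    rcases S.eq_empty_or_nonempty with rfl | hne
    · refine ⟨b, by simp, ?_⟩
      have := mul_le_mul_of_nonneg_right (h1 b (by simp)) hP
      simpa using this
    · obtain ⟨x, hx, hxle⟩ := ih (fun x hx => h1 x (by simp [hx]))
        (fun x hx y hy => h2 x (by simp [hx]) y (by simp [hy])) hne
      refine ⟨b, by simp, ?_⟩
      have hlt := hb x hx
      have h3 := h2 b (by simp) x (by simp [hx]) hlt.ne'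
      rw [abs_of_pos (by linarith)] at h3
      have hnot : b ∉ S := fun h => lt_irrefl _ (hb b h)
      rw [Finset.card_insert_of_notMem hnot]
      push_cast
      nlinarith

theorem abs_sub_le_vol (J : Set ℝ) (hb : Bornology.IsBounded J) (hc : J.OrdConnected)
    (x y : ℝ) (hx : x ∈ J) (hy : y ∈ J) : |x - y| ≤ (volume J).toReal := by
  have h : volume (Set.uIcc y x) ≤ volume J := measure_mono (hc.uIcc_subset hy hx)
  rw [Real.volume_interval] at h
  exact (ENNReal.ofReal_le_iff_le_toReal hb.measure_lt_top.ne).1 h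

theorem finset_bound (d : ℕ) (Λ : Set (Fin d → ℝ)) (hΛ : IsLattice Λ)
    (hadm : 0 < Nm Λ) (I : Fin d → Set ℝ)
    (hI : ∀ i, Bornology.IsBounded (I i) ∧ (I i).OrdConnected)
    (F : Finset (Fin d → ℝ)) (hF : (F : Set (Fin d → ℝ)) ⊆ Λ ∩ Set.univ.pi I) :
    (F.card : ℝ) ≤ (volume (Set.univ.pi I)).toReal / Nm Λ + 1 := by
  have hsub : ∀ x ∈ Λ, ∀ y ∈ Λ, x - y ∈ Λ := by
    obtain ⟨T, -, rfl⟩ := hΛ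
    rintro _ ⟨u, rfl⟩ _ ⟨v, rfl⟩
    refine ⟨u - v, ?_⟩
    simp only
    rw [← Matrix.mulVec_sub]
    congr 1
    ext i
    simp
  have hNm : ∀ x ∈ Λ, ∀ y ∈ Λ, x ≠ y → Nm Λ ≤ ∏ j, |x j - y j| := by
    intro x hx y hy hne
    refine csInf_le ⟨0, ?_⟩ ⟨x - y, hsub x hx y hy, sub_ne_zero.2 hne, rfl⟩
    rintro p ⟨z, -, -, rfl⟩
    exact Finset.prod_nonneg fun _ _ => abs_nonneg _
  rcases F.eq_empty_or_nonempty with rfl | hne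
  · simp only [Finset.card_empty, Nat.cast_zero]
    positivity
  cases d with
  | zero =>
    exfalso
    have : {p : ℝ | ∃ z ∈ Λ, z ≠ 0 ∧ p = ∏ j, |z j|} = ∅ := by
      ext p
      simp only [Set.mem_ofPred_eq, Set.mem_empty_iff_false, iff_false]
      rintro ⟨z, -, h, -⟩
      exact h (Subsingleton.elim _ _)
    rw [Nm, this, Real.sInf_empty] at hadm
    exact lt_irrefl _ hadm
  | succ n =>
    have hvol : (volume (Set.univ.pi I)).toReal =
        (volume (I 0)).toReal * ∏ j : Fin n, (volume (I j.succ)).toReal := by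
      rw [volume_pi_pi, ENNReal.toReal_prod, Fin.prod_univ_succ]
    set P := ∏ j : Fin n, (volume (I j.succ)).toReal with hPdef
    have hP : 0 ≤ P := Finset.prod_nonneg fun _ _ => ENNReal.toReal_nonneg
    have hmem : ∀ x ∈ F, ∀ i, x i ∈ I i := fun x hx i => (hF hx).2 i (Set.mem_univ i)
    have hsep : ∀ x ∈ F, ∀ y ∈ F, x ≠ y → Nm Λ ≤ |x 0 - y 0| * P := by
      intro x hx y hy hxy
      refine (hNm x (hF hx).1 y (hF hy).1 hxy).trans ?_
      rw [Fin.prod_univ_succ]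
      refine mul_le_mul_of_nonneg_left ?_ (abs_nonneg _)
      exact Finset.prod_le_prod (fun _ _ => abs_nonneg _) fun j _ =>
        abs_sub_le_vol _ (hI _).1 (hI _).2 _ _ (hmem x hx _) (hmem y hy _)
    have hinj : Set.InjOn (fun x : Fin (n+1) → ℝ => x 0) (F : Set (Fin (n+1) → ℝ)) := by
      intro x hx y hy h
      by_contra hxy
      have h1 := hsep x hx y hy hxy
      have h2 : x 0 = y 0 := h
      rw [h2] at h1
      simp at h1
      linarith
    obtain ⟨m, hmF, hm⟩ := F.exists_min_image (fun x => x 0) hne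
    obtain ⟨x, hx, hle⟩ := sep_aux P (Nm Λ) (m 0) hP (F.image fun x => x 0)
      (by
        intro x hx
        obtain ⟨y, hy, rfl⟩ := Finset.mem_image.1 hx
        exact hm y hy)
      (by
        intro x hx y hy hxy
        obtain ⟨x, hx2, rfl⟩ := Finset.mem_image.1 hx
        obtain ⟨y, hy2, rfl⟩ := Finset.mem_image.1 hy
        exact hsep x hx2 y hy2 fun h => hxy (by rw [h]))
      (hne.image _)
    obtain ⟨y, hy, rfl⟩ := Finset.mem_image.1 hx
    rw [Finset.card_image_of_injOn hinj] at hle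
    have h5 := (le_abs_self _).trans
      (abs_sub_le_vol _ (hI 0).1 (hI 0).2 _ _ (hmem y hy 0) (hmem m hmF 0))
    have h6 := mul_le_mul_of_nonneg_right h5 hP
    rw [hvol, ← sub_le_iff_le_add, le_div_iff₀ hadm]
    linarith

/-- Counting bound: an axis-parallel box `B` contains at most `|B|/Nm(Λ) + 1`
points of an admissible lattice `Λ`; in particular `Λ ∩ B` is finite. -/
theorem card_inter_box_le (d : ℕ) (Λ : Set (Fin d → ℝ)) (hΛ : IsLattice Λ)
    (hadm : 0 < Nm Λ) (I : Fin d → Set ℝ)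
    (hI : ∀ i, Bornology.IsBounded (I i) ∧ (I i).OrdConnected) :
    (Λ ∩ Set.univ.pi I).Finite ∧
      ((Λ ∩ Set.univ.pi I).ncard : ℝ) ≤
        (volume (Set.univ.pi I)).toReal / Nm Λ + 1 := by
  have key := finset_bound d Λ hΛ hadm I hI
  have hfin : (Λ ∩ Set.univ.pi I).Finite := by
    by_contra hinf
    obtain ⟨k, hk⟩ := exists_nat_gt ((volume (Set.univ.pi I)).toReal / Nm Λ + 1)
    obtain ⟨F, hF, hc⟩ := Set.Infinite.exists_subset_card_eq hinf k
    have := key F hF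
    rw [hc] at this
    linarith
  refine ⟨hfin, ?_⟩
  rw [Set.ncard_eq_toFinset_card _ hfin]
  exact key _ (by simp)
end
end

section
/- Let T ∈ ℝ^{d×d} be invertible, let Λ = T(ℤ^d) and let Λ* = (T^{-1})^⊤(ℤ^d) be the dual lattice. Then Λ is admissible if and only if Λ* is admissible, i.e., Nm(Λ) > 0 if and only if Nm(Λ*) > 0. -/
open MeasureTheory Set ENNReal

noncomputable section

theorem minkowski_forms {d : ℕ} (M : Matrix (Fin d) (Fin d) ℝ) (hM : M.det ≠ 0)
    (b : Fin d → ℝ) (hb : ∀ i, 0 < b i) (h : |M.det| < ∏ i, b i) :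
    ∃ z : Fin d → ℤ, z ≠ 0 ∧ ∀ i, |M.mulVec (fun i => (z i : ℝ)) i| < b i := by
  classical
  let s : Set (Fin d → ℝ) := (Matrix.toLin' M) ⁻¹' (Set.univ.pi fun i => Set.Ioo (-b i) (b i))
  have hdet : LinearMap.det (Matrix.toLin' M) ≠ 0 := by rwa [LinearMap.det_toLin']
  have hvol : volume s = ENNReal.ofReal (|M.det|⁻¹ * ∏ i, (2 * b i)) := by
    rw [Measure.addHaar_preimage_linearMap volume hdet, LinearMap.det_toLin', abs_inv,
      Real.volume_pi_Ioo, ENNReal.ofReal_mul (by positivity),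
      ENNReal.ofReal_prod_of_nonneg (fun i _ => by have := hb i; positivity)]
    congr 2
    ext i
    congr 1
    ring
  have hconv : Convex ℝ s :=
    (convex_pi fun i _ => convex_Ioo _ _).linear_preimage (Matrix.toLin' M)
  have hsymm : ∀ x ∈ s, -x ∈ s := by
    intro x hx
    simp only [s, Set.mem_preimage, Set.mem_pi, Set.mem_univ, forall_true_left, Set.mem_Ioo,
      map_neg, Pi.neg_apply] at hx ⊢
    intro i
    have := hx i
    constructor <;> linarith [this.1, this.2]
  let B := Pi.basisFun ℝ (Fin d)
  have fund := ZSpan.isAddFundamentalDomain' B volume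
  have hF : volume (ZSpan.fundamentalDomain B) = 1 := by
    rw [ZSpan.volume_fundamentalDomain]
    have : Matrix.of (B : Fin d → Fin d → ℝ) = 1 := by
      ext i j
      simp [B, Matrix.one_apply, Pi.single_apply, eq_comm]
    rw [this]; simp
  have : Countable (Submodule.span ℤ (Set.range B)).toAddSubgroup :=
    inferInstanceAs (Countable (Submodule.span ℤ (Set.range B)))
  obtain ⟨x, hx0, hxs⟩ := exists_ne_zero_mem_lattice_of_measure_mul_two_pow_lt_measure
    fund hsymm hconv (by
      rw [hF, hvol, one_mul, Module.finrank_fin_fun, Finset.prod_mul_distrib]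
      rw [show (2 : ℝ≥0∞) ^ d = ENNReal.ofReal (2 ^ d) by
        rw [ENNReal.ofReal_pow (by norm_num)]; simp]
      rw [ENNReal.ofReal_lt_ofReal_iff_of_nonneg (by positivity)]
      have h0 : 0 < |M.det| := abs_pos.mpr hM
      simp only [Finset.prod_const, Finset.card_univ, Fintype.card_fin]
      rw [inv_mul_eq_div, lt_div_iff₀ h0]
      exact mul_lt_mul_of_pos_left h (by positivity))
  have hmem := x.2
  have hz : ∀ i, ∃ n : ℤ, (n : ℝ) = (x : Fin d → ℝ) i := by
    intro i
    have := (B.mem_span_iff_repr_mem ℤ (x : Fin d → ℝ)).1 hmem i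
    simpa [B] using this
  choose z hz using hz
  have hzx : (fun i => (z i : ℝ)) = (x : Fin d → ℝ) := funext hz
  refine ⟨z, ?_, ?_⟩
  · rintro rfl
    apply hx0
    ext i
    rw [← hz i]; simp
  · intro i
    rw [hzx, abs_lt]
    have := hxs
    simp only [s, Set.mem_preimage, Set.mem_pi, Set.mem_univ, forall_true_left, Set.mem_Ioo,
      Matrix.toLin'_apply] at this
    exact this i

theorem core_bound {d : ℕ} (T : Matrix (Fin d) (Fin d) ℝ) (hT : IsUnit T.det) (c : ℝ)
    (hc : ∀ x ∈ latticeOf T, x ≠ 0 → c ≤ ∏ j, |x j|)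
    (w : Fin d → ℤ) (y : Fin d → ℝ) (hy : y = (T⁻¹).transpose.mulVec fun i => (w i : ℝ))
    (k : Fin d) (hk : y k ≠ 0) (a : Fin d → ℝ) (ha : ∀ j, 0 < a j) (hay : ∀ j, |y j| ≤ a j)
    (hak : a k = |y k|) (R : ℝ) (hR : 0 < R) (hV : |T.det| * ∏ j, a j < R ^ (d - 1)) :
    c * ∏ j, a j ≤ ((d - 1 : ℕ) : ℝ) * R * R ^ (d - 1) := by
  classical
  have hT0 : T.det ≠ 0 := hT.ne_zero
  have hyT : Matrix.vecMul y T = fun i => (w i : ℝ) := by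
    rw [hy, Matrix.mulVec_transpose, Matrix.vecMul_vecMul, Matrix.nonsing_inv_mul _ hT,
      Matrix.vecMul_one]
  let M := T.updateRow k (∑ j, y j • T j)
  have hMdet : M.det = y k * T.det := Matrix.det_updateRow_sum T k y
  let b : Fin d → ℝ := fun j => if j = k then 1 else R / a j
  have hb : ∀ j, 0 < b j := by
    intro j
    have := ha j
    simp only [b]; split_ifs <;> positivity
  have hcard : (Finset.univ.erase k).card = d - 1 := by simp
  have hprodb : (∏ j, b j) * ∏ j, a j = R ^ (d - 1) * a k := by
    rw [← Finset.mul_prod_erase _ b (Finset.mem_univ k),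
      ← Finset.mul_prod_erase _ a (Finset.mem_univ k)]
    have h1 : ∏ j ∈ Finset.univ.erase k, b j = ∏ j ∈ Finset.univ.erase k, (R / a j) :=
      Finset.prod_congr rfl fun j hj => by simp [b, Finset.ne_of_mem_erase hj]
    have h2 : (∏ j ∈ Finset.univ.erase k, (R / a j)) * ∏ j ∈ Finset.univ.erase k, a j
        = R ^ (d - 1) := by
      rw [← Finset.prod_mul_distrib, ← hcard, ← Finset.prod_const]
      exact Finset.prod_congr rfl fun j _ => div_mul_cancel₀ _ (ha j).ne'
    rw [h1, ← h2]
    simp only [b, if_true]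
    ring
  have hA : 0 < ∏ j, a j := Finset.prod_pos fun j _ => ha j
  obtain ⟨z, hz0, hz⟩ := minkowski_forms M (by rw [hMdet]; exact mul_ne_zero hk hT0) b hb (by
    rw [hMdet, abs_mul, ← hak]
    refine lt_of_mul_lt_mul_right ?_ hA.le
    rw [hprodb]
    have := mul_lt_mul_of_pos_right hV (ha k)
    linarith)
  set x := T.mulVec (fun i => (z i : ℝ)) with hx
  have hx0 : x ≠ 0 := by
    intro h0
    apply hz0
    have := Matrix.eq_zero_of_mulVec_eq_zero hT0 (hx ▸ h0)
    funext i
    have := congrFun this i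
    simpa using this
  have hxj : ∀ j, j ≠ k → |x j| * a j ≤ R := by
    intro j hj
    have h := hz j
    have h1 : M.mulVec (fun i => (z i : ℝ)) j = x j := by
      simp [M, Matrix.mulVec, hx, Matrix.updateRow_ne hj]
    rw [h1] at h
    simp only [b, if_neg hj] at h
    exact ((lt_div_iff₀ (ha j)).1 h).le
  have hdot : ∑ j, y j * x j = 0 := by
    have h1 : ∑ j, y j * x j = ∑ i, (w i : ℝ) * (z i : ℝ) := by
      have : y ⬝ᵥ x = Matrix.vecMul y T ⬝ᵥ (fun i => (z i : ℝ)) :=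
        Matrix.dotProduct_mulVec _ _ _
      rw [hyT] at this
      exact this
    have h2 : M.mulVec (fun i => (z i : ℝ)) k = ∑ j, y j * x j := by
      have h3 : (∑ j, y j • T j) = Matrix.vecMul y T := by
        ext i; simp [Matrix.vecMul, dotProduct]
      have : M.mulVec (fun i => (z i : ℝ)) k = (∑ j, y j • T j) ⬝ᵥ (fun i => (z i : ℝ)) := by
        simp only [M, Matrix.mulVec, Matrix.updateRow_self]
      rw [this, h3, ← Matrix.dotProduct_mulVec]
      rfl
    have h := hz k
    rw [h2, h1] at h
    simp only [b, if_true] at h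
    rw [h1]
    have h4 : |∑ i, w i * z i| < 1 := by exact_mod_cast h
    have := Int.abs_lt_one_iff.1 h4
    exact_mod_cast this
  have hxk : |x k| * a k ≤ ((d - 1 : ℕ) : ℝ) * R := by
    rw [← Finset.add_sum_erase _ _ (Finset.mem_univ k)] at hdot
    have h1 : |x k| * a k = |∑ j ∈ Finset.univ.erase k, y j * x j| := by
      rw [hak, ← abs_mul, ← abs_neg (x k * y k)]
      congr 1; linarith
    rw [h1, ← hcard, ← nsmul_eq_mul]
    refine (Finset.abs_sum_le_sum_abs _ _).trans (Finset.sum_le_card_nsmul _ _ _ ?_)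
    intro j hj
    rw [abs_mul, mul_comm]
    exact (mul_le_mul_of_nonneg_left (hay j) (abs_nonneg _)).trans
      (hxj j (Finset.ne_of_mem_erase hj))
  calc c * ∏ j, a j ≤ (∏ j, |x j|) * ∏ j, a j :=
        mul_le_mul_of_nonneg_right (hc x ⟨z, rfl⟩ hx0) hA.le
    _ = (|x k| * a k) * ∏ j ∈ Finset.univ.erase k, (|x j| * a j) := by
        rw [← Finset.prod_mul_distrib,
          ← Finset.mul_prod_erase _ (fun j => |x j| * a j) (Finset.mem_univ k)]
    _ ≤ _ := by
        refine mul_le_mul hxk ?_ (Finset.prod_nonneg fun j _ =>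
          mul_nonneg (abs_nonneg _) (ha j).le) (by positivity)
        rw [← hcard, ← Finset.prod_const]
        exact Finset.prod_le_prod (fun j _ => mul_nonneg (abs_nonneg _) (ha j).le)
          fun j hj => hxj j (Finset.ne_of_mem_erase hj)

theorem exists_threshold (n : ℕ) (V c : ℝ) (hV : 0 < V) (hc : 0 < c) :
    ∃ p : ℝ, 0 < p ∧ ∀ A : ℝ, 0 < A → A < p →
      ∃ R : ℝ, 0 < R ∧ V * A < R ^ n ∧ (n : ℝ) * R * R ^ n < c * A := by
  rcases Nat.eq_zero_or_pos n with rfl | hn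
  · refine ⟨V⁻¹, by positivity, fun A hA hAp => ⟨1, one_pos, ?_, ?_⟩⟩
    · rw [pow_zero]
      have := mul_lt_mul_of_pos_left hAp hV
      rwa [mul_inv_cancel₀ hV.ne'] at this
    · simp; positivity
  · have hn' : (0 : ℝ) < n := by exact_mod_cast hn
    set R0 : ℝ := c / (2 * V * n) with hR0
    have hR0p : 0 < R0 := by positivity
    refine ⟨R0 ^ n / (2 * V), by positivity, fun A hA hAp => ?_⟩
    have hpow : ((2 * V * A) ^ ((n : ℝ)⁻¹)) ^ n = 2 * V * A :=
      Real.rpow_inv_natCast_pow (by positivity) hn.ne'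
    refine ⟨(2 * V * A) ^ ((n : ℝ)⁻¹), by positivity, ?_, ?_⟩
    · rw [hpow]; nlinarith [mul_pos hV hA]
    · have hlt : (2 * V * A) ^ ((n : ℝ)⁻¹) < R0 := by
        refine lt_of_pow_lt_pow_left₀ n hR0p.le ?_
        rw [hpow]
        rw [lt_div_iff₀ (by positivity)] at hAp
        linarith
      rw [hpow]
      have h1 : (n : ℝ) * R0 * (2 * V * A) = c * A := by
        rw [hR0]; field_simp
      rw [← h1]
      gcongr

theorem Nm_pos_of_bound {d : ℕ} (hd : 0 < d) (T : Matrix (Fin d) (Fin d) ℝ)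
    (hT : IsUnit T.det) (c : ℝ) (hc0 : 0 < c)
    (hc : ∀ x ∈ latticeOf T, x ≠ 0 → c ≤ ∏ j, |x j|) : 0 < Nm (latticeOf T) := by
  refine lt_of_lt_of_le hc0 (le_csInf ?_ ?_)
  · let z : Fin d → ℤ := fun _ => 1
    refine ⟨_, T.mulVec (fun i => (z i : ℝ)), ⟨z, rfl⟩, ?_, rfl⟩
    intro h0
    have := congrFun (Matrix.eq_zero_of_mulVec_eq_zero hT.ne_zero h0) ⟨0, hd⟩
    simp [z] at this
  · rintro p ⟨z, hz, hz0, rfl⟩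
    exact hc z hz hz0

theorem dual_admissible_of_admissible (d : ℕ) (T : Matrix (Fin d) (Fin d) ℝ)
    (hT : IsUnit T.det) (h : 0 < Nm (latticeOf T)) :
    0 < Nm (latticeOf (T⁻¹).transpose) := by
  have hd : 0 < d := by
    rcases Nat.eq_zero_or_pos d with rfl | hd
    · exfalso
      have he : {p : ℝ | ∃ z ∈ latticeOf T, z ≠ 0 ∧ p = ∏ j, |z j|} = ∅ := by
        ext p
        simp only [Set.mem_ofPred_eq, Set.mem_empty_iff_false, iff_false]
        rintro ⟨z, _, hz, _⟩
        exact hz (Subsingleton.elim _ _)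
      rw [Nm, he, Real.sInf_empty] at h
      exact lt_irrefl _ h
    · exact hd
  have hc : ∀ x ∈ latticeOf T, x ≠ 0 → Nm (latticeOf T) ≤ ∏ j, |x j| := by
    intro x hx hx0
    refine csInf_le ⟨0, ?_⟩ ⟨x, hx, hx0, rfl⟩
    rintro p ⟨z, _, _, rfl⟩
    exact Finset.prod_nonneg fun j _ => abs_nonneg _
  obtain ⟨p, hp, hpA⟩ := exists_threshold (d - 1) |T.det| _ (abs_pos.2 hT.ne_zero) h
  have hT' : IsUnit (T⁻¹).transpose.det := by
    rw [Matrix.det_transpose]; exact Matrix.isUnit_nonsing_inv_det T hT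
  refine Nm_pos_of_bound hd _ hT' p hp ?_
  rintro y ⟨w, hw⟩ hy0
  obtain ⟨k, hk⟩ : ∃ k, y k ≠ 0 := Function.ne_iff.1 hy0
  have hk' : 0 < |y k| := abs_pos.2 hk
  have hcont : Continuous fun δ : ℝ => ∏ j, max |y j| δ := by fun_prop
  have hlim : Filter.Tendsto (fun δ : ℝ => ∏ j, max |y j| δ) (nhdsWithin 0 (Set.Ioi 0))
      (nhds (∏ j, |y j|)) := by
    have := (hcont.tendsto 0).mono_left (nhdsWithin_le_nhds (s := Set.Ioi 0))
    simpa using this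
  refine ge_of_tendsto hlim ?_
  filter_upwards [Ioo_mem_nhdsGT hk'] with δ hδ
  by_contra hlt
  have ha : ∀ j, 0 < max |y j| δ := fun j => lt_max_of_lt_right hδ.1
  obtain ⟨R, hR, h1, h2⟩ := hpA _ (Finset.prod_pos fun j _ => ha j) (not_le.1 hlt)
  exact absurd (core_bound T hT _ hc w y hw.symm k hk (fun j => max |y j| δ) ha
    (fun j => le_max_left _ _) (max_eq_left hδ.2.le) R hR h1) (not_le.2 h2)

/-- A lattice is admissible if and only if its dual lattice is admissible. -/
theorem admissible_iff_dual_admissible (d : ℕ) (T : Matrix (Fin d) (Fin d) ℝ)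
    (hT : IsUnit T.det) :
    0 < Nm (latticeOf T) ↔ 0 < Nm (latticeOf (T⁻¹).transpose) := by
  refine ⟨dual_admissible_of_admissible d T hT, fun h => ?_⟩
  have hT' : IsUnit (T⁻¹).transpose.det := by
    rw [Matrix.det_transpose]; exact Matrix.isUnit_nonsing_inv_det T hT
  have := dual_admissible_of_admissible d _ hT' h
  rwa [← Matrix.transpose_nonsing_inv, Matrix.transpose_transpose,
    Matrix.nonsing_inv_nonsing_inv T hT] at this
end
end

section
/- Let Λ ⊂ ℝ^d be a lattice with det(Λ) = δ > 0, and suppose there is a constant C < ∞ such that for all x ∈ ℝ^d and all t ∈ ℝ^d with positive coordinates the shifted box B_{x,t} := x + [0,t] satisfies the counting estimate |#(Λ ∩ B_{x,t}) − |B_{x,t}|/δ| ≤ C · (ln(2 + n(t)))^{d−1}, where n(t) = ∏_{j=1}^d t_j = |B_{x,t}|. Then there exists D < ∞, depending only on d, δ and C, such that disp*(Λ) ≤ D; i.e., every axis-parallel box containing no point of Λ has volume at most D. -/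
open MeasureTheory Set ENNReal

noncomputable section

theorem aux_bound (k : ℕ) (δ C : ℝ) (hδ : 0 < δ) :
    ∃ M : ℝ, 0 ≤ M ∧ ∀ V : ℝ, 0 ≤ V → V / δ ≤ C * Real.log (2 + V) ^ k → V ≤ M := by
  have h := (Real.isLittleO_pow_log_id_atTop (n := k))
  have hK : 0 < |C| * δ + 1 := by positivity
  have h2 := h.def (c := 1 / (2 * (|C| * δ + 1))) (by positivity)
  obtain ⟨y0, hy0⟩ := Filter.eventually_atTop.1 h2
  refine ⟨max 2 y0, le_trans (by norm_num) (le_max_left _ _), fun V hV hle => ?_⟩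
  by_contra hcon
  push Not at hcon
  have hV2 : 2 < V := lt_of_le_of_lt (le_max_left _ _) hcon
  have hVy : y0 < V := lt_of_le_of_lt (le_max_right _ _) hcon
  have h3 := hy0 (2 + V) (by linarith)
  have hL : 0 ≤ Real.log (2 + V) ^ k := pow_nonneg (Real.log_nonneg (by linarith)) _
  simp only [id, Real.norm_eq_abs] at h3
  rw [abs_of_nonneg hL, abs_of_nonneg (by linarith : (0 : ℝ) ≤ 2 + V)] at h3
  set L := Real.log (2 + V) ^ k
  rw [div_le_iff₀ hδ] at hle
  have h4 : L * (2 * (|C| * δ + 1)) ≤ 2 + V := by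
    rw [one_div, inv_mul_eq_div, le_div_iff₀ (by positivity)] at h3
    exact h3
  have h5 : C * L * δ ≤ |C| * L * δ := by
    gcongr
    exact le_abs_self C
  nlinarith

/-- From Skriganov's lattice point counting estimate one obtains a uniform bound,
depending only on `d`, `δ` and `C`, on the volume of boxes avoiding the lattice. -/
theorem dispStar_le_of_counting (d : ℕ) (δ C : ℝ) (hδ : 0 < δ) :
    ∃ D : ℝ, ∀ T : Matrix (Fin d) (Fin d) ℝ, IsUnit T.det → |T.det| = δ →
      ∀ Λ : Set (Fin d → ℝ), Λ = latticeOf T →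
        (∀ x t : Fin d → ℝ, (∀ i, 0 < t i) →
          (Λ ∩ Set.univ.pi fun i => Set.Icc (x i) (x i + t i)).Finite ∧
          |((Λ ∩ Set.univ.pi fun i => Set.Icc (x i) (x i + t i)).ncard : ℝ)
              - (∏ i, t i) / δ|
            ≤ C * Real.log (2 + ∏ i, t i) ^ (d - 1)) →
        dispStar Λ ≤ ENNReal.ofReal D := by
  obtain ⟨M, hM0, hM⟩ := aux_bound (d - 1) δ C hδ
  refine ⟨2 ^ d * M, fun T _ _ Λ _ hcount => ?_⟩
  refine iSup₂_le fun B hB => ?_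
  obtain ⟨⟨I, hI, rfl⟩, hE⟩ := hB
  by_cases hne : ∀ i, (I i).Nonempty
  swap
  · push Not at hne
    obtain ⟨i, hi⟩ := hne
    rw [Set.univ_pi_eq_empty hi]
    simp
  have hsub : ∀ i, I i ⊆ Set.Icc (sInf (I i)) (sSup (I i)) := fun i y hy =>
    ⟨csInf_le (hI i).1.bddBelow hy, le_csSup (hI i).1.bddAbove hy⟩
  have hle : volume (Set.univ.pi I) ≤ ∏ i, ENNReal.ofReal (sSup (I i) - sInf (I i)) := by
    refine (measure_mono (Set.pi_mono fun i _ => hsub i)).trans ?_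
    rw [volume_pi_pi]
    simp
  by_cases hlt : ∀ i, sInf (I i) < sSup (I i)
  swap
  · push Not at hlt
    obtain ⟨i, hi⟩ := hlt
    refine hle.trans ?_
    rw [Finset.prod_eq_zero (Finset.mem_univ i)]
    · simp
    · exact ENNReal.ofReal_of_nonpos (by linarith)
  refine hle.trans ?_
  rw [← ENNReal.ofReal_prod_of_nonneg (fun i _ => by linarith [hlt i])]
  apply ENNReal.ofReal_le_ofReal
  obtain ⟨-, hc⟩ := hcount (fun i => sInf (I i) + (sSup (I i) - sInf (I i)) / 4)
    (fun i => (sSup (I i) - sInf (I i)) / 2) (fun i => by linarith [hlt i])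
  have hsub2 : (Set.univ.pi fun i => Set.Icc (sInf (I i) + (sSup (I i) - sInf (I i)) / 4)
      (sInf (I i) + (sSup (I i) - sInf (I i)) / 4 + (sSup (I i) - sInf (I i)) / 2))
      ⊆ Set.univ.pi I := by
    refine Set.pi_mono fun i _ y hy => ?_
    have := hlt i
    obtain ⟨p, hp, hpy⟩ := exists_lt_of_csInf_lt (hne i)
      (show sInf (I i) < y by linarith [hy.1])
    obtain ⟨q, hq, hyq⟩ := exists_lt_of_lt_csSup (hne i)
      (show y < sSup (I i) by linarith [hy.2])
    exact (hI i).2.out hp hq ⟨hpy.le, hyq.le⟩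
  have hemp : (Λ ∩ Set.univ.pi fun i => Set.Icc (sInf (I i) + (sSup (I i) - sInf (I i)) / 4)
      (sInf (I i) + (sSup (I i) - sInf (I i)) / 4 + (sSup (I i) - sInf (I i)) / 2)) = ∅ := by
    rw [Set.eq_empty_iff_forall_notMem]
    rintro y ⟨h1, h2⟩
    have : y ∈ Set.univ.pi I ∩ Λ := ⟨hsub2 h2, h1⟩
    rw [hE] at this
    exact this
  have hpos : 0 ≤ ∏ i, (sSup (I i) - sInf (I i)) / 2 :=
    Finset.prod_nonneg fun i _ => by linarith [hlt i]
  rw [hemp, Set.ncard_empty, Nat.cast_zero, zero_sub, abs_neg,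
    abs_of_nonneg (div_nonneg hpos hδ.le)] at hc
  have hfin := hM _ hpos hc
  have hprod : ∏ i, (sSup (I i) - sInf (I i)) =
      2 ^ d * ∏ i, (sSup (I i) - sInf (I i)) / 2 := by
    rw [Finset.prod_div_distrib]
    simp
    field_simp
  rw [hprod]
  gcongr
end
end

section
/- Let Λ ⊂ ℝ^d be an admissible lattice. Then for every integer N ≥ 1 there exists t ∈ ℝ^d with positive coordinates such that the box [0,t] = [0,t_1] × ⋯ × [0,t_d] contains exactly N points of Λ, i.e., #(Λ ∩ [0,t]) = N. -/
open MeasureTheory Set ENNReal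

noncomputable section

lemma aux_count (A : Finset ℝ) (N : ℕ) (h : N < A.card) :
    ∃ t ∈ A, (A.filter (· < t)).card = N := by
  classical
  induction A using Finset.induction_on_max with
  | empty => simp at h
  | insert a A ha ih =>
    have hna : a ∉ A := fun h => lt_irrefl _ (ha a h)
    rw [Finset.card_insert_of_notMem hna] at h
    rcases Nat.lt_succ_iff_lt_or_eq.mp h with h | h
    · obtain ⟨t, ht, hc⟩ := ih h
      refine ⟨t, Finset.mem_insert_of_mem ht, ?_⟩
      rw [Finset.filter_insert, if_neg (not_lt.mpr (ha t ht).le), hc]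
    · refine ⟨a, Finset.mem_insert_self _ _, ?_⟩
      rw [Finset.filter_insert, if_neg (lt_irrefl a), Finset.filter_true_of_mem ha, h]

lemma aux_count' (A : Finset ℝ) (N : ℕ) (hN : 1 ≤ N) (h : N < A.card) (h0 : ∀ a ∈ A, 0 ≤ a) :
    ∃ t, 0 < t ∧ (∃ a ∈ A, t ≤ a) ∧ (A.filter (· ≤ t)).card = N := by
  obtain ⟨t, ht, hc⟩ := aux_count A N h
  have hne : (A.filter (· < t)).Nonempty := by
    rw [← Finset.card_pos]; omega
  obtain ⟨u, hu, hmax⟩ := Finset.exists_max_image _ id hne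
  simp only [Finset.mem_filter, id] at hu hmax
  have := h0 u hu.1
  refine ⟨(u + t) / 2, by linarith, ⟨t, ht, by linarith⟩, ?_⟩
  rw [← hc]
  congr 1
  apply Finset.filter_congr
  intro x hx
  constructor
  · intro h; linarith
  · intro h; have := hmax x ⟨hx, h⟩; linarith

lemma aux_pos {d : ℕ} (T : Matrix (Fin d) (Fin d) ℝ) (hT : IsUnit T.det) :
    ∃ z : Fin d → ℤ, ∀ i, 0 < T.mulVec (fun i => (z i : ℝ)) i := by
  set R : ℝ := 1 + ∑ i, ∑ j, |T i j| with hR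
  set x : Fin d → ℝ := T⁻¹.mulVec (fun _ => R) with hx
  have hTx : T.mulVec x = fun _ => R := by
    rw [hx, Matrix.mulVec_mulVec, Matrix.mul_nonsing_inv _ hT, Matrix.one_mulVec]
  refine ⟨fun i => ⌊x i⌋, fun i => ?_⟩
  have h1 : ∑ j, T i j * x j = R := congrFun hTx i
  have h2 : ∑ j, T i j * x j - ∑ j, T i j * (⌊x j⌋ : ℝ) ≤ ∑ j, |T i j| := by
    rw [← Finset.sum_sub_distrib]
    apply Finset.sum_le_sum
    intro j _
    rw [← mul_sub]
    have a1 := Int.floor_le (x j)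
    have a2 := Int.lt_floor_add_one (x j)
    calc T i j * (x j - ⌊x j⌋) ≤ |T i j| * (x j - ⌊x j⌋) :=
          mul_le_mul_of_nonneg_right (le_abs_self _) (by linarith)
      _ ≤ |T i j| * 1 := mul_le_mul_of_nonneg_left (by linarith) (abs_nonneg _)
      _ = _ := mul_one _
  have h3 : ∑ j, |T i j| ≤ ∑ i, ∑ j, |T i j| :=
    Finset.single_le_sum (f := fun i => ∑ j, |T i j|)
      (fun i _ => Finset.sum_nonneg fun j _ => abs_nonneg _) (Finset.mem_univ i)
  show 0 < ∑ j, T i j * (⌊x j⌋ : ℝ)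
  linarith

lemma aux_fin {d : ℕ} (T : Matrix (Fin d) (Fin d) ℝ) (hT : IsUnit T.det) (s : Fin d → ℝ) :
    (latticeOf T ∩ Set.univ.pi fun i => Set.Icc (0 : ℝ) (s i)).Finite := by
  set K : Fin d → ℤ := fun i => ⌈∑ j, |T⁻¹ i j| * s j⌉ with hK
  refine ((Set.finite_Icc (-K) K).image
    (fun z : Fin d → ℤ => T.mulVec fun i => (z i : ℝ))).subset ?_
  rintro _ ⟨⟨z, rfl⟩, hz⟩
  refine ⟨z, ?_, rfl⟩
  have hb : ∀ i, |(z i : ℝ)| ≤ K i := by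
    intro i
    have hzi : T⁻¹.mulVec (T.mulVec fun i => (z i : ℝ)) = fun i => (z i : ℝ) := by
      rw [Matrix.mulVec_mulVec, Matrix.nonsing_inv_mul _ hT, Matrix.one_mulVec]
    have := congrFun hzi i
    rw [← this]
    refine le_trans ?_ (Int.le_ceil (∑ j, |T⁻¹ i j| * s j))
    show |∑ j, T⁻¹ i j * (T.mulVec fun i => (z i : ℝ)) j| ≤ _
    refine (Finset.abs_sum_le_sum_abs _ _).trans (Finset.sum_le_sum fun j _ => ?_)
    rw [abs_mul]
    have hj := hz j (Set.mem_univ j)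
    exact mul_le_mul_of_nonneg_left (by rw [abs_of_nonneg hj.1]; exact hj.2) (abs_nonneg _)
  constructor
  · intro i
    have := (abs_le.mp (hb i)).1
    show -K i ≤ z i
    exact_mod_cast this
  · intro i
    exact_mod_cast (abs_le.mp (hb i)).2

lemma aux_inj {d : ℕ} (T : Matrix (Fin d) (Fin d) ℝ) (h : 0 < Nm (latticeOf T)) (i : Fin d) :
    Set.InjOn (fun x : Fin d → ℝ => x i) (latticeOf T) := by
  rintro _ ⟨z, rfl⟩ _ ⟨w, rfl⟩ he
  by_contra hne
  simp only at he hne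
  have hle : Nm (latticeOf T) ≤
      ∏ j, |(T.mulVec (fun i => (z i : ℝ)) - T.mulVec (fun i => (w i : ℝ))) j| := by
    apply csInf_le
    · refine ⟨0, ?_⟩
      rintro _ ⟨y, _, _, rfl⟩
      exact Finset.prod_nonneg fun _ _ => abs_nonneg _
    · refine ⟨_, ⟨z - w, ?_⟩, sub_ne_zero.mpr hne, rfl⟩
      simp only
      rw [← Matrix.mulVec_sub]
      congr 1
      ext i
      simp
  rw [Finset.prod_eq_zero (Finset.mem_univ i) (by simp [he])] at hle
  linarith

/-- For an admissible lattice and every `N ≥ 1` there is a box `[0,t]` containing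
exactly `N` lattice points. -/
theorem exists_box_card_eq (d : ℕ) (hd : 1 ≤ d) (Λ : Set (Fin d → ℝ))
    (hΛ : IsLattice Λ) (hadm : 0 < Nm Λ) (N : ℕ) (hN : 1 ≤ N) :
    ∃ t : Fin d → ℝ, (∀ i, 0 < t i) ∧
      (Λ ∩ Set.univ.pi fun i => Set.Icc (0 : ℝ) (t i)).ncard = N := by
  classical
  obtain ⟨T, hT, rfl⟩ := hΛ
  obtain ⟨z, hz⟩ := aux_pos T hT
  set v := T.mulVec (fun i => (z i : ℝ)) with hv
  let i0 : Fin d := ⟨0, hd⟩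
  have hNpos : (0 : ℝ) < N := by exact_mod_cast hN
  set s : Fin d → ℝ := fun i => N * v i with hs
  have hinj := aux_inj T hadm i0
  set S := (aux_fin T hT s).toFinset with hS
  have hmem : ∀ x, x ∈ S ↔ x ∈ latticeOf T ∧ ∀ i, 0 ≤ x i ∧ x i ≤ s i := by
    intro x; simp only [hS, Set.Finite.mem_toFinset, Set.mem_inter_iff, Set.mem_pi, Set.mem_univ, true_imp_iff, Set.mem_Icc]
  have hinjS : Set.InjOn (fun x : Fin d → ℝ => x i0) S := fun x hx y hy h =>
    hinj ((hmem x).1 hx).1 ((hmem y).1 hy).1 h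
  have hcard : N < (S.image fun x => x i0).card := by
    have hsub : (Finset.range (N + 1)).image (fun k : ℕ => (k : ℝ) * v i0)
        ⊆ S.image fun x => x i0 := by
      intro a ha
      obtain ⟨k, hk, rfl⟩ := Finset.mem_image.1 ha
      have hk' : (k : ℝ) ≤ N := by
        exact_mod_cast Nat.lt_succ_iff.1 (Finset.mem_range.1 hk)
      refine Finset.mem_image.2 ⟨(k : ℝ) • v, (hmem _).2 ⟨⟨fun i => k * z i, ?_⟩, fun i => ?_⟩, ?_⟩
      · simp only [hv]
        rw [← Matrix.mulVec_smul]
        congr 1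
        ext i
        simp
      · simp only [Pi.smul_apply, smul_eq_mul, hs]
        exact ⟨mul_nonneg (Nat.cast_nonneg _) (hz i).le,
          mul_le_mul_of_nonneg_right hk' (hz i).le⟩
      · simp
    have := Finset.card_le_card hsub
    rw [Finset.card_image_of_injective, Finset.card_range] at this
    · omega
    · intro a b hab
      exact_mod_cast mul_right_cancel₀ (hz i0).ne' hab
  obtain ⟨τ, hτ, ⟨a, ha, hτa⟩, hc⟩ := aux_count' _ N hN hcard (by
    intro a ha
    obtain ⟨x, hx, rfl⟩ := Finset.mem_image.1 ha
    exact (((hmem x).1 hx).2 i0).1)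
  obtain ⟨y, hy, rfl⟩ := Finset.mem_image.1 ha
  have hτs : τ ≤ s i0 := hτa.trans (((hmem y).1 hy).2 i0).2
  refine ⟨Function.update s i0 τ, fun i => ?_, ?_⟩
  · by_cases h : i = i0
    · subst h; simpa using hτ
    · rw [Function.update_of_ne h]; exact mul_pos hNpos (hz i)
  · have hset : (latticeOf T ∩ Set.univ.pi fun i => Set.Icc (0 : ℝ) (Function.update s i0 τ i))
        = ((S.filter fun x => x i0 ≤ τ : Finset (Fin d → ℝ)) : Set (Fin d → ℝ)) := by
      ext x
      simp only [Set.mem_inter_iff, Set.mem_pi, Set.mem_univ, true_imp_iff, Set.mem_Icc,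
        Finset.mem_coe, Finset.mem_filter, hmem]
      constructor
      · rintro ⟨h1, h2⟩
        have h3 : x i0 ≤ τ := by simpa using (h2 i0).2
        refine ⟨⟨h1, fun i => ⟨(h2 i).1, ?_⟩⟩, h3⟩
        by_cases h : i = i0
        · rw [h]; exact h3.trans hτs
        · have := (h2 i).2
          rwa [Function.update_of_ne h] at this
      · rintro ⟨⟨h1, h2⟩, h3⟩
        refine ⟨h1, fun i => ⟨(h2 i).1, ?_⟩⟩
        by_cases h : i = i0
        · rw [h]; simpa using h3
        · rw [Function.update_of_ne h]; exact (h2 i).2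
    rw [hset, Set.ncard_coe_finset, ← hc, Finset.filter_image, Finset.card_image_of_injOn]
    exact hinjS.mono (by intro x hx; exact (Finset.mem_filter.1 hx).1)
end
end
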